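/- Let n be even, let S̄ be an F_{q^2}-subspace of F_{q^n} with dim_{F_q}(S̄) = 2l (i.e. dim_{F_{q^2}}(S̄) = l), let b ∈ F_{q^n} \ S̄, and set S = S̄ ⊕ b·F_q and Y = S̄ ⊕ b·F_{q^2}. If Orb(S) ⊆ G_q(n, 2l+1) is a full weight spectrum code, then Orb(S̄), regarded as a one-orbit cyclic subspace code over F_{q^2} in G_{q^2}(n/2, l), is a full weight spectrum code; moreover, the set {dim_{F_{q^2}}(Y ∩ μY) : μ ∈ F_{q^n}^*} contains every value in {1,…,l}. -/

import Mathlib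

/-!
Setting: `q` is a prime power, realized by a finite field `Fq` with `Fintype.card Fq = q`;
`F` plays the role of `F_{q^n}`: a finite field extension of `Fq` with `Module.finrank Fq F = n`.
`F_q`-subspaces of `F_{q^n}` are `Submodule Fq F`; for a divisor `t` of `n`, the subfield
`F_{q^t}` is the (unique) `T : IntermediateField Fq F` with `Module.finrank Fq ↥T = t`, and
`F_{q^t}`-subspaces are `Submodule ↥T F`.
-/

set_option synthInstance.maxHeartbeats 1000000

namespace FWS

variable (R : Type*) {F : Type*} [Field R] [Field F] [Algebra R F]

/-- The cyclic shift `α S = {α * s : s ∈ S}` of an `R`-subspace `S` of `F`. -/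
def shift (α : F) (S : Submodule R F) : Submodule R F :=
  S.map (LinearMap.mulLeft R α)

/-- The subspace distance `d(U,V) = dim U + dim V - 2 dim (U ⊓ V)`
(which is `2k - 2 dim (U ⊓ V)` for `U, V` of the same dimension `k`). -/
noncomputable def sdist (U V : Submodule R F) : ℕ :=
  Module.finrank R ↥U + Module.finrank R ↥V - 2 * Module.finrank R ↥(U ⊓ V)

/-- The one-orbit cyclic subspace code `Orb(S) = {α S : α ∈ F*}`. -/
def orb (S : Submodule R F) : Set (Submodule R F) :=
  {T | ∃ α : F, α ≠ 0 ∧ T = shift R α S}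

/-- The weight `ω_{2i}(Orb(S)) = #{α S : α ∈ F*, d(S, α S) = 2 i}`. -/
noncomputable def omega (S : Submodule R F) (i : ℕ) : ℕ :=
  Nat.card {T : Submodule R F // T ∈ orb R S ∧ sdist R S T = 2 * i}

/-- `Orb(S)` is a full weight spectrum (FWS) code: `ω_{2i} > 0` for all `1 ≤ i ≤ dim S`. -/
def IsFWS (S : Submodule R F) : Prop :=
  ∀ i : ℕ, 1 ≤ i → i ≤ Module.finrank R ↥S → 0 < omega R S i

/-- The subspace `⟨1, l, ..., l^(k-1)⟩_R` spanned by the first `k` powers of `l`. -/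
def polySpan (l : F) (k : ℕ) : Submodule R F :=
  Submodule.span R ((fun i : ℕ => l ^ i) '' Set.Iio k)

/-- The invariant `m(Orb(S))`: the least divisor `t` of `n` such that
`dim_{F_{q^t}} ⟨S⟩_{F_{q^t}} = 1` (equivalently, the degree of the smallest subfield
containing a cyclic shift of `S`). -/
noncomputable def mOrb (S : Submodule R F) : ℕ :=
  sInf {t : ℕ | t ∣ Module.finrank R F ∧
    ∃ T : IntermediateField R F, Module.finrank R ↥T = t ∧
      Module.finrank ↥T ↥(Submodule.span ↥T (S : Set F)) = 1}

/-- The stabilizer `H(S) = {x ∈ F* : x S = S} ∪ {0}` of a set `S ⊆ F`, as a subset of `F`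
(it is a subfield of `F` when `S` is a subspace). -/
def stab {F : Type*} [Field F] (S : Set F) : Set F :=
  {x : F | x ≠ 0 ∧ (fun y => x * y) '' S = S} ∪ {0}

end FWS

open FWS

namespace FWS

section General

variable {R F : Type*} [Field R] [Field F] [Algebra R F]

lemma finrank_shift (S : Submodule R F) {α : F} (hα : α ≠ 0) :
    Module.finrank R ↥(shift R α S) = Module.finrank R ↥S :=
  (Submodule.equivMapOfInjective (LinearMap.mulLeft R α)
    (mul_right_injective₀ hα) S).finrank_eq.symm

lemma sdist_shift (S : Submodule R F) {α : F} (hα : α ≠ 0) :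
    sdist R S (shift R α S) =
      2 * Module.finrank R ↥S - 2 * Module.finrank R ↥(S ⊓ shift R α S) := by
  rw [sdist, finrank_shift S hα, two_mul (Module.finrank R ↥S)]

lemma shift_mono {S T : Submodule R F} (h : S ≤ T) (α : F) : shift R α S ≤ shift R α T :=
  Submodule.map_mono h

lemma omega_pos_iff [Finite F] (S : Submodule R F) {i : ℕ} :
    0 < omega R S i ↔ ∃ α : F, α ≠ 0 ∧ sdist R S (shift R α S) = 2 * i := by
  have : Finite (Submodule R F) := Finite.of_injective _ SetLike.coe_injective
  rw [omega, Nat.card_pos_iff]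
  constructor
  · rintro ⟨⟨_, ⟨α, hα, rfl⟩, h⟩, -⟩
    exact ⟨α, hα, h⟩
  · rintro ⟨α, hα, h⟩
    exact ⟨⟨⟨_, ⟨α, hα, rfl⟩, h⟩⟩, inferInstance⟩

/-- A full weight spectrum code realizes every intersection dimension below `dim S`. -/
lemma IsFWS.exists_finrank_inf_shift_eq [Finite F] {S : Submodule R F} (h : IsFWS R S) {j : ℕ}
    (hj : j < Module.finrank R ↥S) :
    ∃ α : F, α ≠ 0 ∧ Module.finrank R ↥(S ⊓ shift R α S) = j := by
  obtain ⟨α, hα, hd⟩ := (omega_pos_iff S).1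
    (h (Module.finrank R ↥S - j) (by omega) (Nat.sub_le _ _))
  rw [sdist_shift S hα] at hd
  exact ⟨α, hα, by omega⟩

lemma isFWS_of_forall_exists [Finite F] {S : Submodule R F}
    (h : ∀ j < Module.finrank R ↥S,
      ∃ α : F, α ≠ 0 ∧ Module.finrank R ↥(S ⊓ shift R α S) = j) :
    IsFWS R S := by
  intro i hi hi'
  obtain ⟨α, hα, hd⟩ := h (Module.finrank R ↥S - i) (by omega)
  refine (omega_pos_iff S).2 ⟨α, hα, ?_⟩
  rw [sdist_shift S hα]
  omega

end General

section Dimension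

variable {K V : Type*} [Field K] [AddCommGroup V] [Module K V] [FiniteDimensional K V]

lemma finrank_add_finrank_le_of_le {X A C : Submodule K V} (hX : X ≤ C) (hA : A ≤ C) :
    Module.finrank K ↥X + Module.finrank K ↥A ≤
      Module.finrank K ↥(X ⊓ A) + Module.finrank K ↥C := by
  have h := Submodule.finrank_sup_add_finrank_inf_eq X A
  have h' := Submodule.finrank_mono (sup_le hX hA)
  omega

lemma finrank_inf_le_add_two {A B C D : Submodule K V} (hA : A ≤ C) (hB : B ≤ D)
    (hC : Module.finrank K ↥C ≤ Module.finrank K ↥A + 1)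
    (hD : Module.finrank K ↥D ≤ Module.finrank K ↥B + 1) :
    Module.finrank K ↥(C ⊓ D) ≤ Module.finrank K ↥(A ⊓ B) + 2 := by
  have h₁ := finrank_add_finrank_le_of_le (X := C ⊓ D) inf_le_left hA
  have h₂ := finrank_add_finrank_le_of_le (X := C ⊓ D ⊓ A) (inf_le_left.trans inf_le_right) hB
  have h₃ : C ⊓ D ⊓ A ⊓ B ≤ A ⊓ B := inf_le_inf_right B inf_le_right
  have h₄ := Submodule.finrank_mono h₃
  omega

lemma finrank_sup_span_singleton_le (A : Submodule K V) (b : V) :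
    Module.finrank K ↥(A ⊔ Submodule.span K {b}) ≤ Module.finrank K ↥A + 1 :=
  (Submodule.finrank_add_le_finrank_add_finrank _ _).trans
    (Nat.add_le_add_left (by simpa using finrank_span_le_card (R := K) ({b} : Set V)) _)

end Dimension

section Tower

variable {K F : Type*} [Field K] [Field F] [Algebra K F] (T : IntermediateField K F)

lemma finrank_restrictScalars_intermediateField (A : Submodule T F) :
    Module.finrank K ↥(A.restrictScalars K) = Module.finrank K T * Module.finrank T ↥A :=
  (Module.finrank_mul_finrank K T ↥A).symm

lemma finrank_restrictScalars_inf_shift (A : Submodule T F) (α : F) :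
    Module.finrank K ↥(A.restrictScalars K ⊓ shift K α (A.restrictScalars K)) =
      Module.finrank K T * Module.finrank T ↥(A ⊓ shift T α A) :=
  finrank_restrictScalars_intermediateField T (A ⊓ shift T α A)

end Tower

end FWS

/-- Corollary 4.7: if `Orb(S̄ ⊕ b F_q)` is an FWS code in `G_q(n, 2l+1)`,
then `Orb(S̄)` is an FWS code over `F_{q^2}`, and the `F_{q^2}`-dimensions of `Y ⊓ μ Y`
(where `Y = S̄ ⊕ b F_{q^2}`) attain all values in `{1, …, l}`. -/
theorem fws_extension_implies_fws_base
    {Fq F : Type*} [Field Fq] [Field F] [Algebra Fq F] [Fintype Fq] [Fintype F]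
    (q n : ℕ) (hq : Fintype.card Fq = q) (hn : Module.finrank Fq F = n) (hneven : Even n)
    (T2 : IntermediateField Fq F) (hT2 : Module.finrank Fq ↥T2 = 2)
    (Sbar : Submodule ↥T2 F) (l : ℕ) (hSbar : Module.finrank ↥T2 ↥Sbar = l)
    (b : F) (hb : b ∉ Sbar)
    (S : Submodule Fq F) (hS : S = Sbar.restrictScalars Fq ⊔ Submodule.span Fq {b})
    (hSdim : Module.finrank Fq ↥S = 2 * l + 1)
    (Y : Submodule ↥T2 F) (hY : Y = Sbar ⊔ Submodule.span ↥T2 {b})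
    (hFWS : IsFWS Fq S) :
    IsFWS ↥T2 Sbar ∧
    ∀ i : ℕ, 1 ≤ i → i ≤ l →
      ∃ μ : F, μ ≠ 0 ∧ Module.finrank ↥T2 ↥(Y ⊓ shift ↥T2 μ Y) = i := by
  have hfin : Module.finrank Fq ↥(Sbar.restrictScalars Fq) = 2 * l := by
    rw [finrank_restrictScalars_intermediateField, hT2, hSbar]
  have hSbarS : Sbar.restrictScalars Fq ≤ S := hS ▸ le_sup_left
  have hSY : S ≤ Y.restrictScalars Fq := by
    subst hS hY
    refine sup_le (fun x hx => Submodule.mem_sup_left hx) ?_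
    rw [Submodule.span_singleton_le_iff_mem]
    exact Submodule.mem_sup_right (Submodule.mem_span_singleton_self b)
  have hYfin : Module.finrank Fq ↥(Y.restrictScalars Fq) ≤ 2 * l + 2 := by
    have h := finrank_sup_span_singleton_le Sbar b
    rw [← hY, hSbar] at h
    rw [finrank_restrictScalars_intermediateField, hT2]
    omega
  have key : ∀ j < l, ∃ α : F, α ≠ 0 ∧
      Module.finrank ↥T2 ↥(Sbar ⊓ shift ↥T2 α Sbar) = j ∧
      Module.finrank ↥T2 ↥(Y ⊓ shift ↥T2 α Y) = j + 1 := by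
    intro j hj
    obtain ⟨α, hα, hd⟩ := hFWS.exists_finrank_inf_shift_eq (j := 2 * j + 1) (by omega)
    have h₁ := Submodule.finrank_mono (inf_le_inf hSbarS (shift_mono hSbarS α))
    have h₂ := Submodule.finrank_mono (inf_le_inf hSY (shift_mono hSY α))
    have h₃ := finrank_inf_le_add_two hSbarS (shift_mono hSbarS α) (by omega)
      (by rw [finrank_shift _ hα, finrank_shift _ hα]; omega)
    have h₄ := finrank_inf_le_add_two hSY (shift_mono hSY α) (by omega)
      (by rw [finrank_shift _ hα, finrank_shift _ hα]; omega)
    rw [finrank_restrictScalars_inf_shift, hT2] at h₁ h₂ h₃ h₄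
    exact ⟨α, hα, by omega, by omega⟩
  constructor
  · refine isFWS_of_forall_exists fun j hj => ?_
    obtain ⟨α, hα, h, -⟩ := key j (hSbar ▸ hj)
    exact ⟨α, hα, h⟩
  · intro i hi hil
    obtain ⟨α, hα, -, h⟩ := key (i - 1) (by omega)
    exact ⟨α, hα, by omega⟩
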